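/- Consider scalings K_n, P_n, α_n such that α_n(1 − q(θ_n)) ∼ c·(log n)/n as n → ∞ for some constant c with 0 < c < 1. Then for any nondecreasing subsequence k ↦ n_k with lim_{k→∞} n_k = ∞ along which the limit lim_{k→∞} α_{n_k} log n_k exists in [0,∞], it holds that lim_{k→∞} P_{n_k}(θ_{n_k}, α_{n_k}) = 0. -/

import Mathlib

open Filter Finset

noncomputable section

/-- Key rings: `K`-element subsets of a pool `{1,…,P}` of keys. -/
abbrev KeyRing (P K : ℕ) : Type := {S : Finset (Fin P) // S.card = K}

/-- Unordered node pairs, represented as ordered pairs `(i,j)` with `i < j`. -/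
abbrev Pairs (n : ℕ) : Type := {e : Fin n × Fin n // e.1 < e.2}

/-- The number `C(P,K)` of possible key rings. -/
def numKR (P K : ℕ) : ℝ := (P.choose K : ℝ)

/-- Probability weight of a configuration `(κ, b)` under the product of the uniform
distribution on key rings (i.i.d. over the `n` nodes) and i.i.d. Bernoulli(α)
on/off link variables (one per unordered pair of nodes). -/
def wt (n P K : ℕ) (α : ℝ) (κ : Fin n → KeyRing P K) (b : Pairs n → Bool) : ℝ :=
  (numKR P K)⁻¹ ^ n * ∏ e : Pairs n, (if b e then α else 1 - α)

/-- The on/off state of the channel between nodes `i` and `j`. -/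
def link {n : ℕ} (b : Pairs n → Bool) (i j : Fin n) : Bool :=
  if h : i < j then b ⟨(i, j), h⟩
  else if h' : j < i then b ⟨(j, i), h'⟩
  else false

/-- Adjacency in the intersection graph `K ∩ G(n; θ, α)`:  the key rings of `i` and `j`
intersect and the channel between them is on. -/
abbrev Adj {n P K : ℕ} (κ : Fin n → KeyRing P K) (b : Pairs n → Bool) (i j : Fin n) : Prop :=
  i ≠ j ∧ ((κ i).1 ∩ (κ j).1).Nonempty ∧ link b i j = true

/-- Node `i` is isolated: it is adjacent to no other node. -/
abbrev Isolated {n P K : ℕ} (κ : Fin n → KeyRing P K) (b : Pairs n → Bool) (i : Fin n) : Prop :=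
  ∀ j, ¬ Adj κ b i j

/-- `P_n(θ,α)`: probability that `K ∩ G(n; θ, α)` contains no isolated nodes. -/
def probNoIsolated (n P K : ℕ) (α : ℝ) : ℝ :=
  ∑ κ : Fin n → KeyRing P K, ∑ b : Pairs n → Bool,
    wt n P K α κ b * (if ∀ i, ¬ Isolated κ b i then 1 else 0)

/-- Number of isolated nodes in the configuration `(κ, b)`. -/
def numIsolated {n P K : ℕ} (κ : Fin n → KeyRing P K) (b : Pairs n → Bool) : ℕ :=
  (Finset.univ.filter fun i => Isolated κ b i).card

/-- `E[I_n(θ,α)]`: expected number of isolated nodes in `K ∩ G(n; θ, α)`. -/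
def expIsolated (n P K : ℕ) (α : ℝ) : ℝ :=
  ∑ κ : Fin n → KeyRing P K, ∑ b : Pairs n → Bool,
    wt n P K α κ b * (numIsolated κ b : ℝ)

/-- `q(θ) = C(P−K,K)/C(P,K)` if `2K ≤ P`, and `0` otherwise. -/
def q (K P : ℕ) : ℝ :=
  if 2 * K ≤ P then ((P - K).choose K : ℝ) / (P.choose K : ℝ) else 0

/-- `v(θ;r) = C(P−r,K)/C(P,K)` if `r ≤ P−K`, and `0` otherwise. -/
def v (K P r : ℕ) : ℝ :=
  if r ≤ P - K then ((P - r).choose K : ℝ) / (P.choose K : ℝ) else 0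

end

noncomputable section

/-- Pair factor. -/
def af {P K : ℕ} (α : ℝ) (S T : KeyRing P K) : ℝ := if (S.1 ∩ T.1).Nonempty then 1 - α else 1

lemma af_comm {P K : ℕ} (α : ℝ) (S T : KeyRing P K) : af α S T = af α T S := by
  unfold af; rw [Finset.inter_comm]

lemma af_nonneg {P K : ℕ} {α : ℝ} (h1 : α ≤ 1) (S T : KeyRing P K) : 0 ≤ af α S T := by
  unfold af; split_ifs <;> linarith

lemma af_le {P K : ℕ} {α : ℝ} (h0 : 0 ≤ α) (S T : KeyRing P K) : af α S T ≤ 1 := by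
  unfold af; split_ifs <;> linarith

lemma sum_prod_fun {ι κ : Type*} [Fintype ι] [DecidableEq ι] [Fintype κ] (g : ι → κ → ℝ) :
    ∑ b : ι → κ, ∏ e, g e (b e) = ∏ e, ∑ x, g e x := by
  rw [Finset.prod_univ_sum]
  simp

lemma isolated_iff {n P K : ℕ} (κ : Fin n → KeyRing P K) (b : Pairs n → Bool) (A : Finset (Fin n)) :
    (∀ i ∈ A, Isolated κ b i) ↔ ∀ e : Pairs n,
      ¬ (((e.1.1 ∈ A ∨ e.1.2 ∈ A) ∧ ((κ e.1.1).1 ∩ (κ e.1.2).1).Nonempty) ∧ b e = true) := by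
  constructor
  · rintro h ⟨⟨i, j⟩, hij⟩ ⟨⟨h1 | h1, h2⟩, h3⟩
    · refine h i h1 j ⟨ne_of_lt hij, h2, ?_⟩
      simp only [link]; rw [dif_pos hij]; exact h3
    · refine h j h1 i ⟨ne_of_gt hij, ?_, ?_⟩
      · rw [Finset.inter_comm]; exact h2
      · simp only [link]; rw [dif_neg (not_lt_of_gt hij), dif_pos hij]; exact h3
  · rintro h i hi j ⟨hne, h2, h3⟩
    rcases lt_or_gt_of_ne hne with hlt | hlt
    · refine h ⟨(i, j), hlt⟩ ⟨⟨Or.inl hi, h2⟩, ?_⟩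
      simp only [link] at h3; rw [dif_pos hlt] at h3; exact h3
    · refine h ⟨(j, i), hlt⟩ ⟨⟨Or.inr hi, ?_⟩, ?_⟩
      · rw [Finset.inter_comm]; exact h2
      · simp only [link] at h3; rw [dif_neg (not_lt_of_gt hlt), dif_pos hlt] at h3; exact h3

lemma sum_b {n P K : ℕ} (α : ℝ) (κ : Fin n → KeyRing P K) (A : Finset (Fin n)) :
    ∑ b : Pairs n → Bool, (∏ e : Pairs n, (if b e then α else 1 - α)) *
      (if ∀ i ∈ A, Isolated κ b i then (1 : ℝ) else 0)
    = ∏ e ∈ (univ : Finset (Fin n × Fin n)).filter (fun e => e.1 < e.2),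
        (if e.1 ∈ A ∨ e.2 ∈ A then af α (κ e.1) (κ e.2) else 1) := by
  obtain ⟨g, hg⟩ : ∃ g : Pairs n → Bool → ℝ, ∀ e x, g e x = (if x then α else 1 - α) *
        (if ((e.1.1 ∈ A ∨ e.1.2 ∈ A) ∧ ((κ e.1.1).1 ∩ (κ e.1.2).1).Nonempty) ∧ x = true
          then (0 : ℝ) else 1) := ⟨_, fun _ _ => rfl⟩
  have h1 : ∀ b : Pairs n → Bool, (∏ e : Pairs n, (if b e then α else 1 - α)) *
      (if ∀ i ∈ A, Isolated κ b i then (1 : ℝ) else 0) =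
      ∏ e : Pairs n, g e (b e) := by
    intro b
    simp only [hg]
    rw [Finset.prod_mul_distrib]
    congr 1
    by_cases h : ∀ i ∈ A, Isolated κ b i
    · rw [if_pos h]
      rw [isolated_iff] at h
      symm
      apply Finset.prod_eq_one
      intro e _
      rw [if_neg (h e)]
    · rw [if_neg h]
      rw [isolated_iff] at h
      push Not at h
      obtain ⟨e, he⟩ := h
      symm
      apply Finset.prod_eq_zero (Finset.mem_univ e)
      rw [if_pos he]
  rw [Finset.sum_congr rfl (fun b _ => h1 b), sum_prod_fun]
  rw [Finset.prod_subtype (p := fun e : Fin n × Fin n => e.1 < e.2)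
    (univ.filter (fun e : Fin n × Fin n => e.1 < e.2)) (by simp)]
  apply Finset.prod_congr rfl
  intro e _
  simp only [Fintype.sum_bool, af, hg]
  by_cases h1 : e.1.1 ∈ A ∨ e.1.2 ∈ A <;>
    by_cases h2 : ((κ e.1.1).1 ∩ (κ e.1.2).1).Nonempty <;> simp [h1, h2]

/-- The ordered pair. -/
def ph {n : ℕ} (i l : Fin n) : Fin n × Fin n := (min i l, max i l)

lemma ph_inj {n : ℕ} (i : Fin n) : Function.Injective (ph i) := by
  intro a b h
  simp only [ph, Prod.mk.injEq] at h
  grind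

lemma af_ph {n P K : ℕ} (α : ℝ) (κ : Fin n → KeyRing P K) (i l : Fin n) :
    af α (κ (ph i l).1) (κ (ph i l).2) = af α (κ i) (κ l) := by
  simp only [ph]
  rcases le_total i l with h | h
  · simp [h]
  · simp only [h, min_eq_right, max_eq_left]; exact af_comm _ _ _

lemma prod_single {n P K : ℕ} (α : ℝ) (κ : Fin n → KeyRing P K) (i : Fin n) :
    ∏ e ∈ (univ : Finset (Fin n × Fin n)).filter (fun e => e.1 < e.2),
        (if e.1 ∈ ({i} : Finset (Fin n)) ∨ e.2 ∈ ({i} : Finset (Fin n))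
          then af α (κ e.1) (κ e.2) else 1)
    = ∏ l ∈ univ.erase i, af α (κ i) (κ l) := by
  rw [← Finset.prod_subset (s₁ := (univ.erase i).image (ph i))]
  · rw [Finset.prod_image (fun a _ b _ h => ph_inj i h)]
    apply Finset.prod_congr rfl
    intro l _
    rw [if_pos, af_ph]
    simp only [ph, Finset.mem_singleton]
    grind
  · intro e he
    simp only [ph, mem_image, mem_erase, mem_filter, mem_univ, true_and, and_true] at he ⊢
    obtain ⟨a, ha, rfl⟩ := he
    grind
  · rintro ⟨a, b⟩ he hne
    simp only [mem_filter, mem_univ, true_and] at he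
    rw [if_neg]
    simp only [Finset.mem_singleton]
    rintro (rfl | rfl)
    · apply hne
      simp only [ph, mem_image, mem_erase, mem_univ, and_true]
      exact ⟨b, he.ne', by simp [he.le]⟩
    · apply hne
      simp only [ph, mem_image, mem_erase, mem_univ, and_true]
      exact ⟨a, he.ne, by simp [he.le]⟩

lemma prod_pair_le {n P K : ℕ} {α : ℝ} (h0 : 0 ≤ α) (h1 : α ≤ 1) (κ : Fin n → KeyRing P K)
    (i j : Fin n) (hij : i ≠ j) :
    ∏ e ∈ (univ : Finset (Fin n × Fin n)).filter (fun e => e.1 < e.2),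
        (if e.1 ∈ ({i, j} : Finset (Fin n)) ∨ e.2 ∈ ({i, j} : Finset (Fin n))
          then af α (κ e.1) (κ e.2) else 1)
    ≤ ∏ l ∈ univ \ {i, j}, (af α (κ i) (κ l) * af α (κ j) (κ l)) := by
  have hdis : Disjoint ((univ \ {i, j}).image (ph i)) ((univ \ {i, j}).image (ph j)) := by
    rw [Finset.disjoint_left]
    intro e he he'
    simp only [ph, mem_image, Finset.mem_sdiff, mem_univ, true_and, mem_insert, mem_singleton] at he he'
    obtain ⟨a, ha, rfl⟩ := he
    obtain ⟨b, hb, hb'⟩ := he'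
    simp only [Prod.mk.injEq] at hb'
    grind
  have hsub : ((univ \ {i, j}).image (ph i)) ∪ ((univ \ {i, j}).image (ph j)) ⊆
      (univ : Finset (Fin n × Fin n)).filter (fun e => e.1 < e.2) := by
    intro e he
    simp only [ph, mem_union, mem_image, Finset.mem_sdiff, mem_univ, true_and, mem_insert,
      mem_singleton, mem_filter] at he ⊢
    rcases he with ⟨a, ha, rfl⟩ | ⟨a, ha, rfl⟩ <;> grind
  have hval : ∀ s ∈ ({i, j} : Finset (Fin n)), ∏ e ∈ (univ \ {i, j}).image (ph s),
      (if e.1 ∈ ({i, j} : Finset (Fin n)) ∨ e.2 ∈ ({i, j} : Finset (Fin n))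
          then af α (κ e.1) (κ e.2) else 1) = ∏ l ∈ univ \ {i, j}, af α (κ s) (κ l) := by
    intro s hs
    rw [Finset.prod_image (fun a _ b _ h => ph_inj s h)]
    apply Finset.prod_congr rfl
    intro l _
    rw [if_pos, af_ph]
    rcases le_total s l with h | h
    · left; simp only [ph, min_eq_left h]; exact hs
    · right; simp only [ph, max_eq_left h]; exact hs
  rw [Finset.prod_mul_distrib, ← hval i (by simp), ← hval j (by simp), ← Finset.prod_union hdis]
  rw [← Finset.prod_sdiff hsub]
  refine mul_le_of_le_one_left ?_ ?_
  · apply Finset.prod_nonneg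
    intro e _
    split_ifs
    · exact af_nonneg h1 _ _
    · norm_num
  · apply Finset.prod_le_one
    · intro e _
      split_ifs
      · exact af_nonneg h1 _ _
      · norm_num
    · intro e _
      split_ifs
      · exact af_le h0 _ _
      · norm_num

lemma sum_kappa_single {n P K : ℕ} (α : ℝ) (i : Fin n) :
    ∑ κ : Fin n → KeyRing P K, ∏ l ∈ univ.erase i, af α (κ i) (κ l)
    = ∑ S : KeyRing P K, (∑ T : KeyRing P K, af α S T) ^ (n - 1) := by
  obtain ⟨g, hg⟩ : ∃ g : KeyRing P K → Fin n → KeyRing P K → ℝ, ∀ S l T, g S l T =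
        if l = i then (if T = S then (1 : ℝ) else 0) else af α S T := ⟨_, fun _ _ _ => rfl⟩
  have h1 : ∀ κ : Fin n → KeyRing P K, ∏ l ∈ univ.erase i, af α (κ i) (κ l) =
      ∑ S : KeyRing P K, ∏ l, g S l (κ l) := by
    intro κ
    simp only [hg]
    rw [Finset.sum_eq_single (κ i)]
    · rw [← Finset.mul_prod_erase univ _ (Finset.mem_univ i)]
      simp only [if_true, one_mul]
      apply Finset.prod_congr rfl
      intro l hl
      rw [if_neg (Finset.ne_of_mem_erase hl)]
    · intro S _ hS
      apply Finset.prod_eq_zero (Finset.mem_univ i)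
      simp [hS.symm]
    · simp
  rw [Finset.sum_congr rfl (fun κ _ => h1 κ), Finset.sum_comm]
  apply Finset.sum_congr rfl
  intro S _
  rw [sum_prod_fun, ← Finset.mul_prod_erase univ _ (Finset.mem_univ i)]
  simp only [hg]
  simp only [if_true, Finset.sum_ite_eq', Finset.mem_univ, one_mul]
  rw [Finset.prod_congr rfl (g := fun _ => ∑ T : KeyRing P K, af α S T)]
  · simp
  · intro l hl
    simp [Finset.ne_of_mem_erase hl]

lemma sum_kappa_pair {n P K : ℕ} (α : ℝ) (i j : Fin n) (hij : i ≠ j) :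
    ∑ κ : Fin n → KeyRing P K, ∏ l ∈ univ \ {i, j}, (af α (κ i) (κ l) * af α (κ j) (κ l))
    = ∑ S : KeyRing P K, ∑ S' : KeyRing P K,
      (∑ T : KeyRing P K, af α S T * af α S' T) ^ (n - 2) := by
  have split : ∀ f : Fin n → ℝ, ∏ l, f l = f i * f j * ∏ l ∈ univ \ {i, j}, f l := by
    intro f
    rw [← Finset.prod_sdiff (Finset.subset_univ {i, j}), Finset.prod_pair hij, mul_comm]
  obtain ⟨g, hg⟩ : ∃ g : KeyRing P K → KeyRing P K → Fin n → KeyRing P K → ℝ,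
      ∀ S S' l T, g S S' l T =
        if l = i then (if T = S then (1 : ℝ) else 0) else
        if l = j then (if T = S' then (1 : ℝ) else 0) else af α S T * af α S' T :=
    ⟨_, fun _ _ _ _ => rfl⟩
  have h1 : ∀ κ : Fin n → KeyRing P K,
      ∏ l ∈ univ \ {i, j}, (af α (κ i) (κ l) * af α (κ j) (κ l)) =
      ∑ S : KeyRing P K, ∑ S' : KeyRing P K, ∏ l, g S S' l (κ l) := by
    intro κ
    simp only [hg]
    rw [Finset.sum_eq_single (κ i), Finset.sum_eq_single (κ j)]
    · rw [split]
      simp only [if_true, hij.symm, if_false, one_mul]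
      apply Finset.prod_congr rfl
      intro l hl
      simp only [Finset.mem_sdiff, mem_univ, true_and, mem_insert, mem_singleton, not_or] at hl
      rw [if_neg hl.1, if_neg hl.2]
    · intro S _ hS
      apply Finset.prod_eq_zero (Finset.mem_univ j)
      simp [hS.symm, hij.symm]
    · simp
    · intro S _ hS
      apply Finset.sum_eq_zero
      intro S' _
      apply Finset.prod_eq_zero (Finset.mem_univ i)
      simp [hS.symm]
    · simp
  rw [Finset.sum_congr rfl (fun κ _ => h1 κ), Finset.sum_comm]
  apply Finset.sum_congr rfl
  intro S _
  rw [Finset.sum_comm]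
  apply Finset.sum_congr rfl
  intro S' _
  rw [sum_prod_fun, split]
  simp only [hg]
  simp only [if_true, hij.symm, if_false, Finset.sum_ite_eq', Finset.mem_univ, one_mul]
  rw [Finset.prod_congr rfl (g := fun _ => ∑ T : KeyRing P K, af α S T * af α S' T)]
  · rw [Finset.prod_const, Finset.card_sdiff_of_subset (Finset.subset_univ _), Finset.card_pair hij]
    simp
  · intro l hl
    simp only [Finset.mem_sdiff, mem_univ, true_and, mem_insert, mem_singleton, not_or] at hl
    simp [hl.1, hl.2]

lemma q_eq (K P : ℕ) (h : K < P) : q K P = ((P - K).choose K : ℝ) / (P.choose K : ℝ) := by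
  unfold q
  split_ifs with h2
  · rfl
  · rw [Nat.choose_eq_zero_of_lt (by omega)]; simp

lemma card_disj {P K : ℕ} (D : Finset (Fin P)) :
    ((univ : Finset (KeyRing P K)).filter (fun T => ¬ (D ∩ T.1).Nonempty)).card
      = (P - D.card).choose K := by
  have : (P - D.card) = (univ \ D).card := by
    rw [Finset.card_sdiff_of_subset (Finset.subset_univ _)]; simp
  rw [this, ← Finset.card_powersetCard]
  apply Finset.card_bij (fun T _ => T.1)
  · rintro ⟨T, hT⟩ h
    simp only [mem_filter, mem_univ, true_and, Finset.not_nonempty_iff_eq_empty] at h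
    rw [Finset.mem_powersetCard]
    refine ⟨?_, hT⟩
    intro x hx
    simp only [Finset.mem_sdiff, mem_univ, true_and]
    intro hD
    have : x ∈ D ∩ T := Finset.mem_inter.2 ⟨hD, hx⟩
    rw [h] at this; simp at this
  · intro a _ b _ h
    exact Subtype.ext h
  · intro T hT
    rw [Finset.mem_powersetCard] at hT
    refine ⟨⟨T, hT.2⟩, ?_, rfl⟩
    simp only [mem_filter, mem_univ, true_and, Finset.not_nonempty_iff_eq_empty]
    ext x
    simp only [mem_inter, notMem_empty, iff_false]
    rintro ⟨h1, h2⟩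
    have := hT.1 h2
    simp at this; exact this h1

lemma card_keyring {P K : ℕ} : Fintype.card (KeyRing P K) = P.choose K := by
  have := card_disj (P := P) (K := K) ∅
  simpa using this

lemma choose_logconc (P K : ℕ) :
    (P - 2 * K).choose K * P.choose K ≤ (P - K).choose K * (P - K).choose K := by
  by_cases h : 3 * K ≤ P
  · have h1 : (P - 2 * K).descFactorial K * P.descFactorial K ≤
        (P - K).descFactorial K * (P - K).descFactorial K := by
      simp only [Nat.descFactorial_eq_prod_range]
      rw [← Finset.prod_mul_distrib, ← Finset.prod_mul_distrib]
      apply Finset.prod_le_prod'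
      intro i hi
      rw [Finset.mem_range] at hi
      obtain ⟨a, ha⟩ : ∃ a, P - 2 * K - i = a := ⟨_, rfl⟩
      rw [ha, show P - i = a + 2 * K by omega, show P - K - i = a + K by omega]
      nlinarith
    simp only [Nat.descFactorial_eq_factorial_mul_choose] at h1
    have h2 := Nat.factorial_pos K
    have h3 : K.factorial * K.factorial * ((P - 2 * K).choose K * P.choose K) ≤
        K.factorial * K.factorial * ((P - K).choose K * (P - K).choose K) := by nlinarith
    exact Nat.le_of_mul_le_mul_left h3 (Nat.mul_pos h2 h2)
  · rcases Nat.eq_zero_or_pos K with rfl | hK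
    · simp
    rw [Nat.choose_eq_zero_of_lt (by omega : P - 2 * K < K)]; simp

end

noncomputable section

/-- Probability that all nodes of `A` are isolated. -/
def EA (n P K : ℕ) (α : ℝ) (A : Finset (Fin n)) : ℝ :=
  ∑ κ : Fin n → KeyRing P K, ∑ b : Pairs n → Bool,
    wt n P K α κ b * (if ∀ i ∈ A, Isolated κ b i then 1 else 0)

lemma EA_eq (n P K : ℕ) (α : ℝ) (A : Finset (Fin n)) :
    EA n P K α A = (numKR P K)⁻¹ ^ n * ∑ κ : Fin n → KeyRing P K,
      ∏ e ∈ (univ : Finset (Fin n × Fin n)).filter (fun e => e.1 < e.2),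
        (if e.1 ∈ A ∨ e.2 ∈ A then af α (κ e.1) (κ e.2) else 1) := by
  unfold EA
  rw [Finset.mul_sum]
  apply Finset.sum_congr rfl
  intro κ _
  rw [← sum_b, Finset.mul_sum]
  apply Finset.sum_congr rfl
  intro b _
  unfold wt
  rw [mul_assoc]

lemma numKR_pos {P K : ℕ} (h : K < P) : 0 < numKR P K := by
  unfold numKR
  exact_mod_cast Nat.choose_pos h.le

lemma card_keyring_real {P K : ℕ} : (Fintype.card (KeyRing P K) : ℝ) = numKR P K := by
  unfold numKR; rw [card_keyring]

lemma EA_empty {n P K : ℕ} (α : ℝ) (h : K < P) : EA n P K α ∅ = 1 := by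
  rw [EA_eq]
  have hp := numKR_pos h
  simp only [Finset.notMem_empty, or_self, if_false, Finset.prod_const_one, Finset.sum_const,
    Finset.card_univ, Fintype.card_fun, Fintype.card_fin, nsmul_eq_mul, mul_one, Nat.cast_pow]
  rw [card_keyring_real, ← mul_pow, inv_mul_cancel₀ hp.ne', one_pow]

/-- Disjointness indicator. -/
def dj {P K : ℕ} (S T : KeyRing P K) : ℝ := if ¬ (S.1 ∩ T.1).Nonempty then 1 else 0

lemma af_dj {P K : ℕ} (α : ℝ) (S T : KeyRing P K) : af α S T = (1 - α) + α * dj S T := by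
  unfold af dj
  by_cases h : (S.1 ∩ T.1).Nonempty <;> simp [h]

lemma sum_dj {P K : ℕ} (h : K < P) (S : KeyRing P K) :
    ∑ T : KeyRing P K, dj S T = numKR P K * q K P := by
  have hp := numKR_pos h
  unfold dj
  rw [Finset.sum_boole, card_disj, S.2, q_eq K P h]
  unfold numKR at *
  field_simp

lemma q_nonneg (K P : ℕ) : 0 ≤ q K P := by
  unfold q; split_ifs <;> positivity

lemma q_le_one {K P : ℕ} (h : K < P) : q K P ≤ 1 := by
  have hp := numKR_pos h
  unfold numKR at hp
  rw [q_eq K P h, div_le_one hp]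
  exact_mod_cast Nat.choose_le_choose K (Nat.sub_le P K)

lemma sum_dj2_le {P K : ℕ} (h : K < P) (S S' : KeyRing P K) :
    ∑ T : KeyRing P K, dj S T * dj S' T ≤ numKR P K * q K P := by
  rw [← sum_dj h S]
  apply Finset.sum_le_sum
  intro T _
  unfold dj
  split_ifs <;> norm_num

lemma sum_dj2_disj {P K : ℕ} (h : K < P) (S S' : KeyRing P K) (hd : ¬ (S.1 ∩ S'.1).Nonempty) :
    ∑ T : KeyRing P K, dj S T * dj S' T ≤ numKR P K * q K P ^ 2 := by
  have hp := numKR_pos h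
  have h1 : ∀ T : KeyRing P K, dj S T * dj S' T =
      if ¬ ((S.1 ∪ S'.1) ∩ T.1).Nonempty then 1 else 0 := by
    intro T
    unfold dj
    simp only [Finset.union_inter_distrib_right, Finset.union_nonempty]
    by_cases h1 : (S.1 ∩ T.1).Nonempty <;> by_cases h2 : (S'.1 ∩ T.1).Nonempty <;> simp [h1, h2]
  have h2 : (S.1 ∪ S'.1).card = 2 * K := by
    rw [Finset.card_union_of_disjoint, S.2, S'.2, two_mul]
    rw [Finset.disjoint_iff_inter_eq_empty]
    exact Finset.not_nonempty_iff_eq_empty.1 hd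
  rw [Finset.sum_congr rfl (fun T _ => h1 T), Finset.sum_boole, card_disj, h2, q_eq K P h]
  have h3 : (((P - 2 * K).choose K : ℝ)) * (P.choose K : ℝ) ≤
      ((P - K).choose K : ℝ) * ((P - K).choose K : ℝ) := by
    exact_mod_cast choose_logconc P K
  unfold numKR at *
  have h4 : (P.choose K : ℝ) * (((P - K).choose K : ℝ) / (P.choose K : ℝ)) ^ 2 =
      ((P - K).choose K : ℝ) * ((P - K).choose K : ℝ) / (P.choose K : ℝ) := by
    field_simp
  rw [h4, le_div_iff₀ hp]
  exact h3

lemma sum_af {P K : ℕ} (α : ℝ) (h : K < P) (S : KeyRing P K) :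
    ∑ T : KeyRing P K, af α S T = numKR P K * (1 - α * (1 - q K P)) := by
  simp only [af_dj]
  rw [Finset.sum_add_distrib, ← Finset.mul_sum, sum_dj h, Finset.sum_const, Finset.card_univ,
    nsmul_eq_mul, card_keyring_real]
  ring

lemma sum_af2 {P K : ℕ} (α : ℝ) (h : K < P) (S S' : KeyRing P K) :
    ∑ T : KeyRing P K, af α S T * af α S' T = numKR P K * ((1 - α) ^ 2 + 2 * α * (1 - α) * q K P)
      + α ^ 2 * ∑ T : KeyRing P K, dj S T * dj S' T := by
  have : ∀ T : KeyRing P K, af α S T * af α S' T = (1 - α) ^ 2 + (α * (1 - α)) * dj S T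
      + (α * (1 - α)) * dj S' T + α ^ 2 * (dj S T * dj S' T) := by
    intro T; rw [af_dj, af_dj]; ring
  simp only [this]
  rw [Finset.sum_add_distrib, Finset.sum_add_distrib, Finset.sum_add_distrib, ← Finset.mul_sum,
    ← Finset.mul_sum, ← Finset.mul_sum, sum_dj h, sum_dj h, Finset.sum_const, Finset.card_univ,
    nsmul_eq_mul, card_keyring_real]
  ring

lemma sum_af2_le {P K : ℕ} (α : ℝ) (h : K < P) (S S' : KeyRing P K) :
    ∑ T : KeyRing P K, af α S T * af α S' T ≤ numKR P K *
      (if ¬ (S.1 ∩ S'.1).Nonempty then (1 - α * (1 - q K P)) ^ 2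
        else (1 - α * (1 - q K P)) ^ 2 + α * (α * (1 - q K P))) := by
  have hp := numKR_pos h
  rw [sum_af2 α h]
  by_cases hd : ¬ (S.1 ∩ S'.1).Nonempty
  · rw [if_pos hd]
    have h1 := mul_le_mul_of_nonneg_left (sum_dj2_disj h S S' hd) (sq_nonneg α)
    nlinarith
  · rw [if_neg hd]
    have h1 := mul_le_mul_of_nonneg_left (sum_dj2_le h S S') (sq_nonneg α)
    have h2 : 0 ≤ numKR P K * (α * (1 - q K P)) ^ 2 := by positivity
    nlinarith

lemma EA_single {n P K : ℕ} (hn : 1 ≤ n) (α : ℝ) (h : K < P) (i : Fin n) :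
    EA n P K α {i} = (1 - α * (1 - q K P)) ^ (n - 1) := by
  have hp := numKR_pos h
  rw [EA_eq]
  simp only [prod_single]
  rw [sum_kappa_single]
  simp only [sum_af α h]
  rw [Finset.sum_const, Finset.card_univ, nsmul_eq_mul, card_keyring_real, mul_pow]
  obtain ⟨m, rfl⟩ : ∃ m, n = m + 1 := ⟨n - 1, by omega⟩
  simp only [Nat.add_sub_cancel, inv_pow]
  rw [pow_succ]
  field_simp

lemma EA_pair {n P K : ℕ} (hn : 2 ≤ n) {α : ℝ} (h0 : 0 ≤ α) (h1 : α ≤ 1) (h : K < P)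
    (i j : Fin n) (hij : i ≠ j) :
    EA n P K α {i, j} ≤ q K P * ((1 - α * (1 - q K P)) ^ 2) ^ (n - 2)
      + (1 - q K P) * ((1 - α * (1 - q K P)) ^ 2 + α * (α * (1 - q K P))) ^ (n - 2) := by
  have hp := numKR_pos h
  rw [EA_eq]
  set A := ((1 - α * (1 - q K P)) ^ 2) with hA
  set B := ((1 - α * (1 - q K P)) ^ 2 + α * (α * (1 - q K P))) with hB
  have hs : ∑ κ : Fin n → KeyRing P K,
      ∏ e ∈ (univ : Finset (Fin n × Fin n)).filter (fun e => e.1 < e.2),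
        (if e.1 ∈ ({i, j} : Finset (Fin n)) ∨ e.2 ∈ ({i, j} : Finset (Fin n))
          then af α (κ e.1) (κ e.2) else 1)
      ≤ numKR P K ^ n * (q K P * A ^ (n - 2) + (1 - q K P) * B ^ (n - 2)) := by
    refine (Finset.sum_le_sum (fun κ _ => prod_pair_le h0 h1 κ i j hij)).trans ?_
    rw [sum_kappa_pair α i j hij]
    have hS : ∀ S : KeyRing P K, ∑ S' : KeyRing P K,
      (∑ T : KeyRing P K, af α S T * af α S' T) ^ (n - 2) ≤
        numKR P K ^ (n - 1) * (q K P * A ^ (n - 2) + (1 - q K P) * B ^ (n - 2)) := by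
      intro S
      have h2 : ∀ S' : KeyRing P K, (∑ T : KeyRing P K, af α S T * af α S' T) ^ (n - 2) ≤
          numKR P K ^ (n - 2) * (B ^ (n - 2) + (A ^ (n - 2) - B ^ (n - 2)) * dj S S') := by
        intro S'
        refine (pow_le_pow_left₀ (Finset.sum_nonneg fun T _ =>
          mul_nonneg (af_nonneg h1 _ _) (af_nonneg h1 _ _)) (sum_af2_le α h S S') _).trans ?_
        rw [mul_pow]
        apply le_of_eq
        congr 1
        unfold dj
        split_ifs <;> ring
      refine (Finset.sum_le_sum (fun S' _ => h2 S')).trans ?_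
      rw [← Finset.mul_sum, Finset.sum_add_distrib, ← Finset.mul_sum, sum_dj h, Finset.sum_const,
        Finset.card_univ, nsmul_eq_mul, card_keyring_real]
      rw [show n - 1 = (n - 2) + 1 by omega, pow_succ]
      apply le_of_eq
      ring
    refine (Finset.sum_le_sum (fun S _ => hS S)).trans ?_
    rw [Finset.sum_const, Finset.card_univ, nsmul_eq_mul, card_keyring_real]
    apply le_of_eq
    have hpw : numKR P K ^ n = numKR P K ^ (n - 1) * numKR P K := by
      rw [← pow_succ]; congr 1; omega
    rw [hpw]
    ring
  refine (mul_le_mul_of_nonneg_left hs (by positivity)).trans ?_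
  rw [← mul_assoc, ← mul_pow, inv_mul_cancel₀ hp.ne', one_pow, one_mul]

lemma wt_nonneg {n P K : ℕ} {α : ℝ} (h0 : 0 ≤ α) (h1 : α ≤ 1) (κ : Fin n → KeyRing P K)
    (b : Pairs n → Bool) : 0 ≤ wt n P K α κ b := by
  unfold wt numKR
  apply mul_nonneg (by positivity)
  apply Finset.prod_nonneg
  intro e _
  split_ifs <;> linarith

lemma prob_nonneg {n P K : ℕ} {α : ℝ} (h0 : 0 ≤ α) (h1 : α ≤ 1) :
    0 ≤ probNoIsolated n P K α := by
  unfold probNoIsolated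
  apply Finset.sum_nonneg; intro κ _
  apply Finset.sum_nonneg; intro b _
  apply mul_nonneg (wt_nonneg h0 h1 κ b)
  split_ifs <;> norm_num

lemma sum_EA {n P K : ℕ} {α : ℝ} {ι : Type} [Fintype ι] (A : ι → Finset (Fin n)) :
    ∑ k, EA n P K α (A k) = ∑ κ : Fin n → KeyRing P K, ∑ b : Pairs n → Bool,
      wt n P K α κ b * (∑ k : ι, if ∀ i ∈ A k, Isolated κ b i then (1 : ℝ) else 0) := by
  unfold EA
  rw [Finset.sum_comm]
  apply Finset.sum_congr rfl; intro κ _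
  rw [Finset.sum_comm]
  apply Finset.sum_congr rfl; intro b _
  rw [Finset.mul_sum]

lemma cheb {n P K : ℕ} {α : ℝ} (h0 : 0 ≤ α) (h1 : α ≤ 1) (t : ℝ) :
    probNoIsolated n P K α ≤ EA n P K α ∅ - 2 * t * ∑ i, EA n P K α {i}
      + t ^ 2 * ∑ i, ∑ j, EA n P K α {i, j} := by
  have hcfg : ∀ (κ : Fin n → KeyRing P K) (b : Pairs n → Bool),
      (if ∀ i, ¬ Isolated κ b i then (1 : ℝ) else 0) ≤
      (if ∀ i ∈ (∅ : Finset (Fin n)), Isolated κ b i then (1 : ℝ) else 0)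
      - 2 * t * (∑ k : Fin n, if ∀ i ∈ ({k} : Finset (Fin n)), Isolated κ b i then (1 : ℝ) else 0)
      + t ^ 2 * (∑ k : Fin n, ∑ l : Fin n,
        if ∀ i ∈ ({k, l} : Finset (Fin n)), Isolated κ b i then (1 : ℝ) else 0) := by
    intro κ b
    obtain ⟨s, hs⟩ : ∃ s : Fin n → ℝ, ∀ k, s k = if Isolated κ b k then (1 : ℝ) else 0 :=
      ⟨_, fun _ => rfl⟩
    have e1 : ∀ k : Fin n, (if ∀ i ∈ ({k} : Finset (Fin n)), Isolated κ b i then (1 : ℝ) else 0)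
        = s k := by
      intro k; rw [hs]; simp only [Finset.mem_singleton, forall_eq]
    have e2 : ∀ k l : Fin n,
        (if ∀ i ∈ ({k, l} : Finset (Fin n)), Isolated κ b i then (1 : ℝ) else 0) = s k * s l := by
      intro k l; rw [hs, hs]
      simp only [Finset.mem_singleton, Finset.mem_insert, forall_eq_or_imp, forall_eq]
      by_cases a1 : Isolated κ b k
      · by_cases a2 : Isolated κ b l
        · rw [if_pos ⟨a1, a2⟩, if_pos a1, if_pos a2, one_mul]
        · rw [if_neg (fun h => a2 h.2), if_neg a2, mul_zero]
      · rw [if_neg (fun h => a1 h.1), if_neg a1, zero_mul]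
    simp only [e1, e2]
    rw [← Finset.sum_mul_sum]
    rw [if_pos (by simp : ∀ i ∈ (∅ : Finset (Fin n)), Isolated κ b i)]
    by_cases hh : ∀ i, ¬ Isolated κ b i
    · rw [if_pos hh]
      have : ∑ k, s k = 0 := Finset.sum_eq_zero (fun k _ => by rw [hs, if_neg (hh k)])
      rw [this]; simp
    · rw [if_neg hh]
      nlinarith [sq_nonneg (1 - t * ∑ k, s k)]
  have hE1 : ∑ k, EA n P K α {k} = ∑ κ : Fin n → KeyRing P K, ∑ b : Pairs n → Bool,
      wt n P K α κ b * (∑ k : Fin n,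
        if ∀ i ∈ ({k} : Finset (Fin n)), Isolated κ b i then (1 : ℝ) else 0) := by
    exact sum_EA (fun k : Fin n => {k})
  have hE2 : ∑ k, ∑ l, EA n P K α {k, l} = ∑ κ : Fin n → KeyRing P K, ∑ b : Pairs n → Bool,
      wt n P K α κ b * (∑ k : Fin n, ∑ l : Fin n,
        if ∀ i ∈ ({k, l} : Finset (Fin n)), Isolated κ b i then (1 : ℝ) else 0) := by
    rw [← Fintype.sum_prod_type' (fun k l => EA n P K α {k, l}),
      sum_EA (fun z : Fin n × Fin n => {z.1, z.2})]
    simp only [Fintype.sum_prod_type]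
  rw [hE1, hE2]
  unfold EA probNoIsolated
  simp only [Finset.mul_sum (s := (univ : Finset (Fin n → KeyRing P K)))]
  simp only [Finset.mul_sum (s := (univ : Finset (Pairs n → Bool)))]
  rw [← Finset.sum_sub_distrib, ← Finset.sum_add_distrib]
  apply Finset.sum_le_sum; intro κ _
  rw [← Finset.sum_sub_distrib, ← Finset.sum_add_distrib]
  apply Finset.sum_le_sum; intro b _
  refine (mul_le_mul_of_nonneg_left (hcfg κ b) (wt_nonneg h0 h1 κ b)).trans (le_of_eq ?_)
  ring

lemma main_bound {n P K : ℕ} (hn : 2 ≤ n) {α : ℝ} (h0 : 0 ≤ α) (h1 : α ≤ 1) (h : K < P)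
    (x : ℝ) (hx : x = α * (1 - q K P)) (hx1 : x < 1) :
    probNoIsolated n P K α ≤ 1 / (n * (1 - x) ^ (n - 1)) + (1 / (1 - x) ^ 2 - 1)
      + (n * x ^ 2 / ((1 - x) ^ 2) ^ 2) * Real.exp (n * x / (1 - x) ^ 2) := by
  have hq0 := q_nonneg K P
  have hq1 := q_le_one h
  have hx0 : 0 ≤ x := by rw [hx]; exact mul_nonneg h0 (by linarith)
  have hy : 0 < 1 - x := by linarith
  have hnp : (0 : ℝ) < n := by exact_mod_cast (by omega : 0 < n)
  set m : ℝ := n * (1 - x) ^ (n - 1) with hm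
  have hmp : 0 < m := by positivity
  have hc := cheb (n := n) (P := P) (K := K) h0 h1 (1 / m)
  rw [EA_empty α h] at hc
  set y := (1 - x) ^ 2 with hydef
  have hyp : 0 < y := by positivity
  set M := q K P * y ^ (n - 2) + (1 - q K P) * (y + α * x) ^ (n - 2) with hM
  have hMp : 0 ≤ M := by
    have : 0 ≤ 1 - q K P := by linarith
    positivity
  have hs1 : ∑ i, EA n P K α {i} = m := by
    simp only [EA_single (by omega : 1 ≤ n) α h, ← hx]
    simp [hm]
  have hs2 : ∑ i, ∑ j, EA n P K α {i, j} ≤ m + n ^ 2 * M := by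
    have hij : ∀ i j : Fin n, EA n P K α {i, j} ≤ (if i = j then (1 - x) ^ (n - 1) else 0) + M := by
      intro i j
      by_cases hij : i = j
      · subst hij
        rw [if_pos rfl, Finset.pair_eq_singleton, EA_single (by omega : 1 ≤ n) α h, ← hx]
        linarith
      · rw [if_neg hij, zero_add]
        have := EA_pair hn h0 h1 h i j hij
        rw [← hx] at this
        exact this
    refine (Finset.sum_le_sum fun i _ => Finset.sum_le_sum fun j _ => hij i j).trans ?_
    simp only [Finset.sum_add_distrib]
    simp [hm]
    apply le_of_eq; ring
  rw [hs1] at hc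
  have hc2 : probNoIsolated n P K α ≤ 1 / m + n ^ 2 * M / m ^ 2 - 1 := by
    have := mul_le_mul_of_nonneg_left hs2 (sq_nonneg (1 / m))
    have e : (1 / m) ^ 2 * (m + n ^ 2 * M) = 1 / m + n ^ 2 * M / m ^ 2 := by field_simp
    have e2 : 2 * (1 / m) * m = 2 := by field_simp
    rw [e] at this; rw [e2] at hc
    linarith
  have hm2 : m ^ 2 = n ^ 2 * (y ^ (n - 2) * y) := by
    rw [← pow_succ, hm, mul_pow, hydef, ← pow_mul, ← pow_mul]
    congr 2
    omega
  have hratio : n ^ 2 * M / m ^ 2 = (q K P + (1 - q K P) * (1 + α * x / y) ^ (n - 2)) / y := by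
    have : (y + α * x) ^ (n - 2) = y ^ (n - 2) * (1 + α * x / y) ^ (n - 2) := by
      rw [← mul_pow]; congr 1; field_simp
    rw [hm2, hM, this]
    field_simp
  set N := n - 2 with hN
  set t := α * x / y with ht
  have ht0 : 0 ≤ t := by positivity
  have hNn : (N : ℝ) ≤ n := by exact_mod_cast Nat.sub_le n 2
  have hexp : (1 + t) ^ N ≤ Real.exp (N * t) := by
    rw [Real.exp_nat_mul]
    apply pow_le_pow_left₀ (by linarith)
    linarith [Real.add_one_le_exp t]
  have hexp2 : Real.exp (N * t) - 1 ≤ (N * t) * Real.exp (N * t) := by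
    have h3 := Real.add_one_le_exp (-(N * t))
    have h4 : Real.exp (-(N * t)) * Real.exp (N * t) = 1 := by
      rw [← Real.exp_add]; simp
    nlinarith [Real.exp_pos (N * t)]
  have hNt : N * t ≤ n * x / y := by
    rw [ht, mul_div_assoc']
    apply div_le_div_of_nonneg_right _ hyp.le
    apply mul_le_mul hNn _ (by positivity) hnp.le
    nlinarith
  have hpt : (1 - q K P) * (N * t) ≤ n * x ^ 2 / y := by
    have : (1 - q K P) * (N * t) = N * x ^ 2 / y := by
      rw [ht]
      have : x ^ 2 = (1 - q K P) * α * x := by rw [hx]; ring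
      rw [this]; ring
    rw [this]
    gcongr
  have hfin : (1 - q K P) * ((1 + t) ^ N - 1) ≤ (n * x ^ 2 / y) * Real.exp (n * x / y) := by
    calc (1 - q K P) * ((1 + t) ^ N - 1) ≤ (1 - q K P) * ((N * t) * Real.exp (N * t)) :=
          mul_le_mul_of_nonneg_left (by linarith) (by linarith)
      _ = ((1 - q K P) * (N * t)) * Real.exp (N * t) := by ring
      _ ≤ (n * x ^ 2 / y) * Real.exp (n * x / y) := by
          apply mul_le_mul hpt (Real.exp_le_exp.2 hNt) (Real.exp_pos _).le
          positivity
  rw [hratio] at hc2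
  have h5 : (q K P + (1 - q K P) * (1 + t) ^ N) / y =
      1 / y + ((1 - q K P) * ((1 + t) ^ N - 1)) / y := by ring
  have h6 := div_le_div_of_nonneg_right hfin hyp.le
  have h7 : (n * x ^ 2 / y) * Real.exp (n * x / y) / y =
      (n * x ^ 2 / y ^ 2) * Real.exp (n * x / y) := by field_simp
  rw [h7] at h6
  rw [h5] at hc2
  linarith

end

lemma zero_law_full
    (K P : ℕ → ℕ) (α : ℕ → ℝ) (c : ℝ) (hc0 : 0 < c) (hc1 : c < 1)
    (hKP : ∀ n, K n < P n)
    (hα : ∀ n, 0 ≤ α n ∧ α n ≤ 1)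
    (hscal : Tendsto
      (fun n => (α n * (1 - q (K n) (P n))) / (c * Real.log n / n)) atTop (nhds 1)) :
    Tendsto (fun n => probNoIsolated n (P n) (K n) (α n)) atTop (nhds 0) := by
  obtain ⟨x, hx⟩ : ∃ x : ℕ → ℝ, ∀ n, x n = α n * (1 - q (K n) (P n)) := ⟨_, fun _ => rfl⟩
  obtain ⟨r, hr⟩ : ∃ r : ℕ → ℝ, ∀ n, r n = x n / (c * Real.log n / n) := ⟨_, fun _ => rfl⟩
  have hr1 : Tendsto r atTop (nhds 1) := by
    refine hscal.congr (fun n => ?_)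
    rw [hr, hx]
  have hx0 : ∀ n, 0 ≤ x n := fun n => by
    rw [hx]; exact mul_nonneg (hα n).1 (by linarith [q_le_one (hKP n)])
  have hxr : ∀ᶠ n : ℕ in atTop, n * x n = r n * (c * Real.log n) := by
    filter_upwards [eventually_ge_atTop 2] with n hn
    have h1 : (1 : ℝ) < n := by exact_mod_cast hn
    have h2 := Real.log_pos h1
    rw [hr]
    field_simp
  have hcast : Tendsto (fun n : ℕ => (n : ℝ)) atTop atTop := tendsto_natCast_atTop_atTop
  have hlogn : Tendsto (fun n : ℕ => Real.log n / n) atTop (nhds 0) := by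
    have h := (Real.isLittleO_log_id_atTop.tendsto_div_nhds_zero).comp hcast
    exact h
  have hxt : Tendsto x atTop (nhds 0) := by
    have h : Tendsto (fun n : ℕ => r n * (c * (Real.log n / n))) atTop (nhds (1 * (c * 0))) :=
      hr1.mul (hlogn.const_mul c)
    rw [mul_zero, mul_zero] at h
    refine h.congr' ?_
    filter_upwards [hxr, eventually_ge_atTop 2] with n hn h2
    have h1 : (0 : ℝ) < n := by exact_mod_cast (by omega : 0 < n)
    have : x n = n * x n / n := by field_simp
    rw [this, hn]; ring
  have hyt : Tendsto (fun n => (1 - x n) ^ 2) atTop (nhds 1) := by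
    have h := (hxt.const_sub 1).pow 2
    simpa using h
  have hrc : Tendsto (fun n => r n * c / (1 - x n) ^ 2) atTop (nhds c) := by
    have h := (hr1.mul_const c).div hyt one_ne_zero
    rw [one_mul, div_one] at h
    exact h
  obtain ⟨s, hs⟩ : ∃ s : ℝ, s = (1 - (1 + c) / 2) / 2 := ⟨_, rfl⟩
  have hs0 : 0 < s := by rw [hs]; linarith
  have hcs : c < 1 - 2 * s := by rw [hs]; linarith
  have hev := hrc.eventually (gt_mem_nhds hcs)
  have hls : Tendsto (fun n : ℕ => Real.log n / (n : ℝ) ^ s) atTop (nhds 0) :=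
    ((isLittleO_log_rpow_atTop hs0).tendsto_div_nhds_zero).comp hcast
  have hns : Tendsto (fun n : ℕ => ((n : ℝ) ^ s)⁻¹) atTop (nhds 0) :=
    ((tendsto_rpow_atTop hs0).comp hcast).inv_tendsto_atTop
  have hF : Tendsto (fun n : ℕ => (((n : ℝ) ^ s)⁻¹) ^ 2 + (1 / (1 - x n) ^ 2 - 1)
      + (r n * c / (1 - x n) ^ 2) ^ 2 * (Real.log n / (n : ℝ) ^ s) ^ 2) atTop (nhds 0) := by
    have h := ((hns.pow 2).add (((tendsto_const_nhds (x := (1 : ℝ))).div hyt one_ne_zero).sub_const 1)).add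
      ((hrc.pow 2).mul (hls.pow 2))
    simpa using h
  refine tendsto_of_tendsto_of_tendsto_of_le_of_le' tendsto_const_nhds hF
    (Eventually.of_forall fun n => prob_nonneg (hα n).1 (hα n).2) ?_
  filter_upwards [hxr, hev, eventually_ge_atTop 2, hxt.eventually (gt_mem_nhds one_pos)]
    with n h1 h2 h3 h4
  have hnp : (0 : ℝ) < n := by exact_mod_cast (by omega : 0 < n)
  have hn1 : (1 : ℝ) < n := by exact_mod_cast h3
  have hl := Real.log_pos hn1
  have hsp : 0 < (n : ℝ) ^ s := Real.rpow_pos_of_pos hnp s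
  have hy : 0 < 1 - x n := by linarith
  refine (main_bound h3 (hα n).1 (hα n).2 (hKP n) (x n) (hx n) h4).trans ?_
  have hE : n * x n / (1 - x n) ^ 2 ≤ (1 - 2 * s) * Real.log n := by
    have : n * x n / (1 - x n) ^ 2 = (r n * c / (1 - x n) ^ 2) * Real.log n := by rw [h1]; ring
    rw [this]
    exact mul_le_mul_of_nonneg_right h2.le hl.le
  have hexp : Real.exp (n * x n / (1 - x n) ^ 2) ≤ n * (((n : ℝ) ^ s)⁻¹) ^ 2 := by
    refine (Real.exp_le_exp.2 hE).trans (le_of_eq ?_)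
    have e1 : Real.exp ((1 - 2 * s) * Real.log n) = (n : ℝ) ^ (1 - 2 * s) := by
      rw [Real.rpow_def_of_pos hnp, mul_comm]
    rw [e1, Real.rpow_sub hnp, Real.rpow_one, two_mul, Real.rpow_add hnp]
    field_simp
  have hT1 : 1 / (n * (1 - x n) ^ (n - 1)) ≤ (((n : ℝ) ^ s)⁻¹) ^ 2 := by
    have a1 : (1 - x n)⁻¹ ≤ Real.exp (x n / (1 - x n) ^ 2) := by
      have b1 : (1 - x n)⁻¹ = x n / (1 - x n) + 1 := by field_simp; ring
      have b2 : x n / (1 - x n) ≤ x n / (1 - x n) ^ 2 := by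
        apply div_le_div_of_nonneg_left (hx0 n) (by positivity)
        nlinarith [hx0 n]
      have := Real.add_one_le_exp (x n / (1 - x n) ^ 2)
      linarith
    have a2 : ((1 - x n)⁻¹) ^ (n - 1) ≤ Real.exp (n * x n / (1 - x n) ^ 2) := by
      have b3 : ((1 - x n)⁻¹) ^ (n - 1) ≤ ((1 - x n)⁻¹) ^ n := by
        apply pow_le_pow_right₀ _ (Nat.sub_le _ _)
        rw [one_le_inv₀ hy]
        linarith [hx0 n]
      refine b3.trans ((pow_le_pow_left₀ (by positivity) a1 n).trans (le_of_eq ?_))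
      rw [← Real.exp_nat_mul]; congr 1; ring
    have a3 : 1 / (n * (1 - x n) ^ (n - 1)) = ((1 - x n)⁻¹) ^ (n - 1) / n := by
      rw [inv_pow]; field_simp
    rw [a3, div_le_iff₀ hnp]
    linarith
  have hT3 : (n * x n ^ 2 / ((1 - x n) ^ 2) ^ 2) * Real.exp (n * x n / (1 - x n) ^ 2) ≤
      (r n * c / (1 - x n) ^ 2) ^ 2 * (Real.log n / (n : ℝ) ^ s) ^ 2 := by
    refine (mul_le_mul_of_nonneg_left hexp (by positivity)).trans (le_of_eq ?_)
    have : (r n * c / (1 - x n) ^ 2) ^ 2 * (Real.log n / (n : ℝ) ^ s) ^ 2 =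
      (r n * (c * Real.log n)) ^ 2 * (((1 - x n) ^ 2) ^ 2)⁻¹ * (((n : ℝ) ^ s)⁻¹) ^ 2 := by field_simp
    rw [this, ← h1]
    field_simp
  linarith


/-- Zero-law along subsequences: if `α_n (1 - q(θ_n)) ∼ c (log n)/n` for some
`0 < c < 1`, then along any nondecreasing subsequence `k ↦ n_k` tending to `∞` for
which `lim_k α_{n_k} log n_k` exists in `[0,∞]` (as an extended real), one has
`P_{n_k}(θ_{n_k}, α_{n_k}) → 0`. -/
theorem zeroLaw_along_subsequences
    (K P : ℕ → ℕ) (α : ℕ → ℝ) (c : ℝ) (hc0 : 0 < c) (hc1 : c < 1)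
    (hK : ∀ n, 0 < K n) (hKP : ∀ n, K n < P n)
    (hα : ∀ n, 0 ≤ α n ∧ α n ≤ 1)
    (hscal : Tendsto
      (fun n => (α n * (1 - q (K n) (P n))) / (c * Real.log n / n)) atTop (nhds 1))
    (nk : ℕ → ℕ) (hmono : Monotone nk) (hnk : Tendsto nk atTop atTop)
    (hlim : ∃ L : EReal, 0 ≤ L ∧
      Tendsto (fun k => ((α (nk k) * Real.log (nk k) : ℝ) : EReal)) atTop (nhds L)) :
    Tendsto (fun k => probNoIsolated (nk k) (P (nk k)) (K (nk k)) (α (nk k)))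
      atTop (nhds 0) := by
  exact (zero_law_full K P α c hc0 hc1 hKP hα hscal).comp hnk
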